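/- arXiv:2509.23174 — 2 statements merged into one kernel-verified Lean document; each statement's English description precedes it below -/
import Mathlib

section
/- Let Y0 and Y1 be real-valued random variables on a probability space (Ω, P) whose cumulative distribution functions F0 and F1 are continuous and strictly increasing, and let C : ℝ → ℝ → ℝ satisfy P(Y0 ≤ y0, Y1 ≤ y1) = C(F0(y0), F1(y1)) for all y0, y1 ∈ ℝ. Then for every fixed y1 ∈ ℝ, for (law of Y0)-almost every y0, the function u ↦ C(u, F1(y1)) is differentiable at F0(y0), and the regular conditional distribution of Y1 given Y0, evaluated at the conditioning value y0 on the set (−∞, y1], equals ∂₀C(F0(y0), F1(y1)), where ∂₀C denotes the partial derivative of C with respect to its first argument. -/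
open MeasureTheory ProbabilityTheory Set

/-- A finite measure on `ℝ` whose distribution function `F` is continuous and strictly increasing
is the pullback of Lebesgue measure along `F`. -/
lemma comap_volume_eq_of_strictMono {ν : Measure ℝ} [IsFiniteMeasure ν] {F : ℝ → ℝ}
    (hF : ∀ y, F y = ν.real (Iic y)) (hFc : Continuous F) (hFm : StrictMono F) :
    volume.comap F = ν := by
  have hemb : MeasurableEmbedding F := hFc.measurableEmbedding hFm.injective
  refine (Measure.ext_of_Ioc' ν (volume.comap F) (fun _ _ _ => measure_ne_top _ _)
    fun s t hst => ?_).symm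
  have himage : F '' Ioc s t = Ioc (F s) (F t) := by
    refine Subset.antisymm ?_ (intermediate_value_Ioc hst.le hFc.continuousOn)
    rintro _ ⟨x, hx, rfl⟩
    exact ⟨hFm hx.1, hFm.monotone hx.2⟩
  rw [hemb.comap_apply, himage, Real.volume_Ioc, hF s, hF t, ← Iic_sdiff_Iic,
    ← measureReal_sdiff (Iic_subset_Iic.2 hst.le) measurableSet_Iic, ofReal_measureReal]

/-- Differentiation with respect to a distribution function: a function `G` such that
`G (F y) = ∫ x in Iic y, g x ∂ν`, where `F` is the continuous, strictly increasing distribution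
function of `ν`, has derivative `g y` at `F y` for `ν`-almost every `y`. -/
lemma ae_hasDerivAt_of_setIntegral_Iic {ν : Measure ℝ} [IsFiniteMeasure ν] {F : ℝ → ℝ}
    (hF : ∀ y, F y = ν.real (Iic y)) (hFc : Continuous F) (hFm : StrictMono F)
    {g G : ℝ → ℝ} (hg : Integrable g ν) (hG : ∀ y, G (F y) = ∫ x in Iic y, g x ∂ν) :
    ∀ᵐ y ∂ν, HasDerivAt G (g y) (F y) := by
  have hemb : MeasurableEmbedding F := hFc.measurableEmbedding hFm.injective
  have hmap : ν.map F = volume.restrict (range F) := by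
    rw [← comap_volume_eq_of_strictMono hF hFc hFm, hemb.map_comap]
  set h : ℝ → ℝ := (range F).indicator (g ∘ Function.invFun F)
  have hgF : (g ∘ Function.invFun F) ∘ F = g := by
    rw [Function.comp_assoc, Function.invFun_comp hFm.injective, Function.comp_id]
  have hhF (y : ℝ) : h (F y) = g y :=
    (indicator_of_mem (mem_range_self y) _).trans (congrFun hgF y)
  have hint : Integrable h := by
    rw [integrable_indicator_iff hemb.measurableSet_range, IntegrableOn, ← hmap,
      hemb.integrable_map_iff, hgF]
    exact hg
  have hGh (y : ℝ) : G (F y) = ∫ u in Iic (F y), h u := by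
    rw [hG, setIntegral_indicator hemb.measurableSet_range,
      ← Measure.restrict_restrict measurableSet_Iic, ← hmap, hemb.setIntegral_map]
    have hpre : F ⁻¹' Iic (F y) = Iic y := by
      ext x
      exact hFm.le_iff_le
    rw [hpre]
    exact integral_congr_ae (ae_of_all _ fun x => (congrFun hgF x).symm)
  have hderiv : ∀ᵐ u ∂(ν.map F), ∀ c, HasDerivAt (fun x => ∫ t in c..x, h t) (h u) u :=
    hmap ▸ ae_restrict_of_ae (_root_.LocallyIntegrable.ae_hasDerivAt_integral hint.locallyIntegrable)
  filter_upwards [ae_of_ae_map hFc.aemeasurable hderiv] with y hy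
  have hlocal : G =ᶠ[nhds (F y)] fun u => G (F y) + ∫ t in (F y)..u, h t := by
    filter_upwards [Ioo_mem_nhds (hFm (sub_one_lt y)) (hFm (lt_add_one y))] with u hu
    obtain ⟨x, -, rfl⟩ :=
      intermediate_value_Ioo (by linarith : y - 1 ≤ y + 1) hFc.continuousOn hu
    rw [← intervalIntegral.integral_Iic_sub_Iic hint.integrableOn hint.integrableOn, hGh, hGh]
    ring
  rw [← hhF y]
  exact ((hy (F y)).const_add _).congr_of_eventuallyEq hlocal

/-- Key differentiation step in the proof of Proposition 1: for every `y1`, for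
`(law of Y0)`-almost every `y0`, the map `u ↦ C u (F1 y1)` is differentiable at `F0 y0` and the
regular conditional distribution of `Y1` given `Y0`, evaluated at `y0` on `(-∞, y1]`, equals
`∂₀C (F0 y0, F1 y1)`. -/
theorem stmt1 {Ω : Type*} [MeasurableSpace Ω]
    (μ : Measure Ω) [IsProbabilityMeasure μ]
    (Y0 Y1 : Ω → ℝ) (hY0 : Measurable Y0) (hY1 : Measurable Y1)
    (F0 F1 : ℝ → ℝ)
    (hF0 : ∀ y, F0 y = (μ {ω | Y0 ω ≤ y}).toReal)
    (hF1 : ∀ y, F1 y = (μ {ω | Y1 ω ≤ y}).toReal)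
    (hF0c : Continuous F0) (hF1c : Continuous F1)
    (hF0m : StrictMono F0) (hF1m : StrictMono F1)
    (C : ℝ → ℝ → ℝ)
    (hC : ∀ y0 y1, (μ {ω | Y0 ω ≤ y0 ∧ Y1 ω ≤ y1}).toReal = C (F0 y0) (F1 y1)) :
    ∀ y1 : ℝ, ∀ᵐ y0 ∂(μ.map Y0),
      DifferentiableAt ℝ (fun u => C u (F1 y1)) (F0 y0) ∧
        (condDistrib Y1 Y0 μ y0 (Set.Iic y1)).toReal =
          deriv (fun u => C u (F1 y1)) (F0 y0) := by
  intro y1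
  have := Measure.isProbabilityMeasure_map (μ := μ) hY0.aemeasurable
  have hmeas : Measurable fun y => condDistrib Y1 Y0 μ y (Iic y1) :=
    Kernel.measurable_coe _ measurableSet_Iic
  have hcdf (y : ℝ) : F0 y = (μ.map Y0).real (Iic y) := by
    rw [hF0, map_measureReal_apply hY0 measurableSet_Iic]
    rfl
  have hint : Integrable (fun y => (condDistrib Y1 Y0 μ y (Iic y1)).toReal) (μ.map Y0) :=
    Integrable.of_bound hmeas.ennreal_toReal.aestronglyMeasurable 1
      (ae_of_all _ fun y => by
        rw [Real.norm_of_nonneg ENNReal.toReal_nonneg]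
        exact measureReal_le_one)
  have hjoint (y : ℝ) : C (F0 y) (F1 y1) =
      ∫ x in Iic y, (condDistrib Y1 Y0 μ x (Iic y1)).toReal ∂(μ.map Y0) := by
    rw [integral_toReal hmeas.aemeasurable (ae_of_all _ fun x => measure_lt_top _ _),
      ← Measure.compProd_apply_prod measurableSet_Iic measurableSet_Iic,
      compProd_map_condDistrib hY1.aemeasurable,
      Measure.map_apply (hY0.prodMk hY1) (measurableSet_Iic.prod measurableSet_Iic), ← hC]
    rfl
  filter_upwards [ae_hasDerivAt_of_setIntegral_Iic (G := fun u => C u (F1 y1))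
    hcdf hF0c hF0m hint hjoint] with y hy
  exact ⟨hy.differentiableAt, hy.deriv.symm⟩
end

section
/- Let n ≥ 1 and let r_{i0}, r_{i1} ∈ {1, …, n} for i = 1, …, n. Define the Bernstein basis polynomials P_{n,k}(u) = (n choose k) u^k (1−u)^{n−k}, the grid values c(k, ℓ) = (1/n) Σ_{i=1}^n 1{r_{i0} ≤ k} · 1{r_{i1} ≤ ℓ} for k, ℓ ∈ {0, …, n}, and the binomial tail functions F_{n,r}(u) = Σ_{s=r}^{n} (n choose s) u^s (1−u)^{n−s}. Then for all u0, u1 ∈ ℝ, Σ_{k=0}^{n} Σ_{ℓ=0}^{n} c(k, ℓ) P_{n,k}(u0) P_{n,ℓ}(u1) = (1/n) Σ_{i=1}^{n} F_{n, r_{i0}}(u0) · F_{n, r_{i1}}(u1); that is, the empirical Bernstein copula of order m = n coincides with the empirical beta copula. -/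
open Finset

/-- The Bernstein basis polynomial `P_{m,k}(u) = (m choose k) u^k (1-u)^(m-k)`. -/
noncomputable def bernsteinPoly (m k : ℕ) (u : ℝ) : ℝ :=
  (m.choose k : ℝ) * u ^ k * (1 - u) ^ (m - k)

/-- The binomial tail function `F_{n,r}(u) = Σ_{s=r}^n (n choose s) u^s (1-u)^(n-s)`,
the CDF of the Beta(r, n+1-r) distribution. -/
noncomputable def binomTail (n r : ℕ) (u : ℝ) : ℝ :=
  ∑ k ∈ Finset.Icc r n, (n.choose k : ℝ) * u ^ k * (1 - u) ^ (n - k)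

/-- The binomial tail is the full Bernstein sum weighted by the indicator of `r ≤ k`. -/
theorem binomTail_eq_sum_ite_mul_bernsteinPoly (n r : ℕ) (u : ℝ) :
    binomTail n r u =
      ∑ k ∈ Finset.range (n + 1), (if r ≤ k then (1 : ℝ) else 0) * bernsteinPoly n k u := by
  simp only [ite_mul, one_mul, zero_mul, ← Finset.sum_filter]
  refine Finset.sum_congr ?_ fun _ _ => rfl
  ext k
  simp only [Finset.mem_Icc, Finset.mem_filter, Finset.mem_range]
  omega

/-- The empirical Bernstein copula of order `m = n` coincides with the empirical beta copula:
with grid coefficients `c(k,ℓ) = (1/n) Σ_i 1{r_{i0} ≤ k} 1{r_{i1} ≤ ℓ}`,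
`Σ_k Σ_ℓ c(k,ℓ) P_{n,k}(u0) P_{n,ℓ}(u1) = (1/n) Σ_i F_{n,r_{i0}}(u0) F_{n,r_{i1}}(u1)`. -/
theorem stmt4 (n : ℕ) (hn : 1 ≤ n) (r0 r1 : Fin n → ℕ)
    (hr0 : ∀ i, r0 i ∈ Finset.Icc 1 n) (hr1 : ∀ i, r1 i ∈ Finset.Icc 1 n)
    (u0 u1 : ℝ) :
    ∑ k ∈ Finset.range (n + 1), ∑ l ∈ Finset.range (n + 1),
      ((1 / (n : ℝ)) * ∑ i : Fin n,
          (if r0 i ≤ k then (1 : ℝ) else 0) * (if r1 i ≤ l then (1 : ℝ) else 0)) *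
        bernsteinPoly n k u0 * bernsteinPoly n l u1
      = (1 / (n : ℝ)) * ∑ i : Fin n, binomTail n (r0 i) u0 * binomTail n (r1 i) u1 := by
  simp only [binomTail_eq_sum_ite_mul_bernsteinPoly, Finset.sum_mul_sum]
  simp only [Finset.mul_sum, Finset.sum_mul]
  symm
  rw [Finset.sum_comm]
  refine Finset.sum_congr rfl fun k _ => ?_
  rw [Finset.sum_comm]
  refine Finset.sum_congr rfl fun l _ => Finset.sum_congr rfl fun i _ => ?_
  ring
end
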